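/- arXiv:1606.08517 — 4 statements merged into one kernel-verified Lean document; each statement's English description precedes it below -/
import Mathlib

section
/- Let A → A' be a ring homomorphism and I ⊆ A an ideal such that A/I → A'/IA' is an isomorphism and Tor_i^A(A/I, A') = 0 for all i > 0. Then for every n ≥ 1, A/I^n → A'/I^nA' is an isomorphism and Tor_i^A(A/I^n, A') = 0 for all i > 0. -/
universe u

open CategoryTheory

open TensorProduct in
lemma lTensor_rTensor_apply {R : Type*} [CommRing R] {M N X Y : Type*} [AddCommGroup M]
    [AddCommGroup N] [AddCommGroup X] [AddCommGroup Y] [Module R M] [Module R N] [Module R X]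
    [Module R Y] (f : M →ₗ[R] N) (c : X →ₗ[R] Y) (x : M ⊗[R] X) :
    c.lTensor N (f.rTensor X x) = f.rTensor Y (c.lTensor M x) := by
  rw [← LinearMap.comp_apply, ← LinearMap.comp_apply, LinearMap.lTensor_comp_rTensor,
    LinearMap.rTensor_comp_lTensor]

lemma lTensor_lTensor_eq_zero {R : Type*} [CommRing R] (M : Type*) {X Y Z : Type*}
    [AddCommGroup M] [AddCommGroup X] [AddCommGroup Y] [AddCommGroup Z] [Module R M] [Module R X]
    [Module R Y] [Module R Z] {a : X →ₗ[R] Y} {b : Y →ₗ[R] Z} (h : b ∘ₗ a = 0)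
    (x : TensorProduct R M X) : b.lTensor M (a.lTensor M x) = 0 := by
  rw [← LinearMap.comp_apply, ← LinearMap.lTensor_comp, h, LinearMap.lTensor_zero,
    LinearMap.zero_apply]

section Chase

variable {R : Type*} [CommRing R] {K F M X₃ X₂ X₁ X₀ : Type*}
  [AddCommGroup K] [AddCommGroup F] [AddCommGroup M] [AddCommGroup X₃] [AddCommGroup X₂]
  [AddCommGroup X₁] [AddCommGroup X₀] [Module R K] [Module R F] [Module R M] [Module R X₃]
  [Module R X₂] [Module R X₁] [Module R X₀]
  {f : K →ₗ[R] F} {g : F →ₗ[R] M} {a : X₃ →ₗ[R] X₂} {b : X₂ →ₗ[R] X₁} {c : X₁ →ₗ[R] X₀}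

/-- Dimension shifting: exactness at the quotient in one degree follows from exactness at the
kernel one degree lower. -/
lemma lTensor_exact_of_kernel (hfg : Function.Exact f g) (hg : Function.Surjective g)
    (hba : b ∘ₗ a = 0) (hcb : c ∘ₗ b = 0) (hinj : Function.Injective (f.rTensor X₀))
    (hK : Function.Exact (b.lTensor K) (c.lTensor K))
    (hF : Function.Exact (a.lTensor F) (b.lTensor F)) :
    Function.Exact (a.lTensor M) (b.lTensor M) := by
  intro x
  refine ⟨fun hx => ?_, ?_⟩
  · obtain ⟨y, rfl⟩ := LinearMap.rTensor_surjective X₂ hg x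
    rw [lTensor_rTensor_apply] at hx
    obtain ⟨z, hz⟩ := (rTensor_exact X₁ hfg hg _).1 hx
    have hcz : c.lTensor K z = 0 := hinj (by
      rw [← lTensor_rTensor_apply, hz, lTensor_lTensor_eq_zero F hcb, map_zero])
    obtain ⟨w, rfl⟩ := (hK z).1 hcz
    obtain ⟨v, hv⟩ := (hF (y - f.rTensor X₂ w)).1 (by
      rw [map_sub, lTensor_rTensor_apply, hz, sub_self])
    refine ⟨g.rTensor X₃ v, ?_⟩
    rw [lTensor_rTensor_apply, hv, map_sub, (rTensor_exact X₂ hfg hg).apply_apply_eq_zero,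
      sub_zero]
  · rintro ⟨y, rfl⟩
    exact lTensor_lTensor_eq_zero M hba y

lemma lTensor_exact_of_extension (hfg : Function.Exact f g) (hg : Function.Surjective g)
    (hcb : c ∘ₗ b = 0) (hinj : Function.Injective (f.rTensor X₀))
    (hK : Function.Exact (b.lTensor K) (c.lTensor K))
    (hM : Function.Exact (b.lTensor M) (c.lTensor M)) :
    Function.Exact (b.lTensor F) (c.lTensor F) := by
  intro x
  refine ⟨fun hx => ?_, ?_⟩
  · obtain ⟨m, hm⟩ := (hM (g.rTensor X₁ x)).1 (by rw [lTensor_rTensor_apply, hx, map_zero])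
    obtain ⟨e, rfl⟩ := LinearMap.rTensor_surjective X₂ hg m
    obtain ⟨k, hk⟩ := (rTensor_exact X₁ hfg hg (x - b.lTensor F e)).1 (by
      rw [map_sub, ← hm, lTensor_rTensor_apply, sub_self])
    obtain ⟨w, rfl⟩ := (hK k).1 (hinj (by
      rw [← lTensor_rTensor_apply, hk, map_sub, hx, lTensor_lTensor_eq_zero F hcb, sub_zero,
        map_zero]))
    refine ⟨e + f.rTensor X₂ w, ?_⟩
    rw [map_add, lTensor_rTensor_apply, hk, add_sub_cancel]
  · rintro ⟨y, rfl⟩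
    exact lTensor_lTensor_eq_zero F hcb y

/-- If the complex `M ⊗ X₃ → M ⊗ X₂ → M ⊗ X₁` computing the first `Tor` is exact, then tensoring
`K → F` with the cokernel of `X₂ → X₁` preserves injectivity. -/
lemma rTensor_injective_of_lTensor_exact (hfg : Function.Exact f g) (hg : Function.Surjective g)
    (hba : b ∘ₗ a = 0) (hbc : Function.Exact b c) (hc : Function.Surjective c)
    (hinj : Function.Injective (f.rTensor X₁))
    (hM : Function.Exact (a.lTensor M) (b.lTensor M)) :
    Function.Injective (f.rTensor X₀) := by
  rw [injective_iff_map_eq_zero]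
  intro z hz
  obtain ⟨k, rfl⟩ := LinearMap.lTensor_surjective K hc z
  rw [← lTensor_rTensor_apply] at hz
  obtain ⟨e, he⟩ := (lTensor_exact F hbc hc _).1 hz
  obtain ⟨m, hm⟩ := (hM (g.rTensor X₂ e)).1 (by
    rw [lTensor_rTensor_apply, he, (rTensor_exact X₁ hfg hg).apply_apply_eq_zero])
  obtain ⟨e', rfl⟩ := LinearMap.rTensor_surjective X₃ hg m
  obtain ⟨w, hw⟩ := (rTensor_exact X₂ hfg hg (e - a.lTensor F e')).1 (by
    rw [map_sub, ← hm, lTensor_rTensor_apply, sub_self])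
  have hk : k = b.lTensor K w := hinj (by
    rw [← lTensor_rTensor_apply, hw, map_sub, lTensor_lTensor_eq_zero F hba, sub_zero, he])
  rw [hk, (lTensor_exact K hbc hc).apply_apply_eq_zero]

end Chase

section Unit

open TensorProduct

variable {R : Type*} [CommRing R] {K F M N : Type*}
  [AddCommGroup K] [AddCommGroup F] [AddCommGroup M] [AddCommGroup N]
  [Module R K] [Module R F] [Module R M] [Module R N] {f : K →ₗ[R] F} {g : F →ₗ[R] M} {e : N}

lemma tmul_surjective_of_surjective (hg : Function.Surjective g)
    (hF : Function.Surjective fun x : F => x ⊗ₜ[R] e) :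
    Function.Surjective fun x : M => x ⊗ₜ[R] e := by
  intro y
  obtain ⟨z, rfl⟩ := LinearMap.rTensor_surjective N hg y
  obtain ⟨x, rfl⟩ := hF z
  exact ⟨g x, rfl⟩

lemma tmul_injective_of_kernel (hfg : Function.Exact f g) (hg : Function.Surjective g)
    (hK : Function.Surjective fun x : K => x ⊗ₜ[R] e)
    (hF : Function.Injective fun x : F => x ⊗ₜ[R] e) :
    Function.Injective fun x : M => x ⊗ₜ[R] e := by
  refine (injective_iff_map_eq_zero ((TensorProduct.mk R M N).flip e)).2 fun m hm => ?_
  obtain ⟨x, rfl⟩ := hg m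
  obtain ⟨y, hy⟩ := (rTensor_exact N hfg hg (x ⊗ₜ e)).1 hm
  obtain ⟨k, rfl⟩ := hK y
  have : f k = x := hF hy
  rw [← this, hfg.apply_apply_eq_zero]

lemma tmul_bijective_of_extension (hfg : Function.Exact f g) (hg : Function.Surjective g)
    (hinj : Function.Injective (f.rTensor N))
    (hK : Function.Bijective fun x : K => x ⊗ₜ[R] e)
    (hM : Function.Bijective fun x : M => x ⊗ₜ[R] e) :
    Function.Bijective fun x : F => x ⊗ₜ[R] e := by
  constructor
  · refine (injective_iff_map_eq_zero ((TensorProduct.mk R F N).flip e)).2 fun x hx => ?_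
    replace hx : x ⊗ₜ[R] e = 0 := hx
    have hgx : g x = 0 := hM.1 (by
      change g.rTensor N (x ⊗ₜ e) = 0 ⊗ₜ e
      rw [hx, map_zero, zero_tmul])
    obtain ⟨k, rfl⟩ := (hfg x).1 hgx
    have : k = 0 := hK.1 (hinj (by
      change f k ⊗ₜ e = f.rTensor N (0 ⊗ₜ e)
      rw [hx, zero_tmul, map_zero]))
    rw [this, map_zero]
  · intro y
    obtain ⟨m, hm⟩ := hM.2 (g.rTensor N y)
    obtain ⟨x, rfl⟩ := hg m
    obtain ⟨z, hz⟩ := (rTensor_exact N hfg hg (y - x ⊗ₜ e)).1 (by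
      rw [map_sub, ← hm]; exact sub_self _)
    obtain ⟨k, rfl⟩ := hK.2 z
    refine ⟨x + f k, ?_⟩
    change (x + f k) ⊗ₜ e = y
    replace hz : f k ⊗ₜ e = y - x ⊗ₜ e := hz
    rw [add_tmul, hz, add_sub_cancel]

lemma tmul_bijective_of_flat (L : Type*) [AddCommGroup L] [Module R L] [Module.Flat R L]
    (hF : Function.Bijective fun x : F => x ⊗ₜ[R] e) :
    Function.Bijective fun x : L ⊗[R] F => x ⊗ₜ[R] e := by
  let u := LinearEquiv.ofBijective ((TensorProduct.mk R F N).flip e) hF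
  have h : (TensorProduct.mk R (L ⊗[R] F) N).flip e =
      (TensorProduct.assoc R L F N).symm.toLinearMap ∘ₗ (u.lTensor L).toLinearMap := by
    ext
    rfl
  change Function.Bijective ((TensorProduct.mk R (L ⊗[R] F) N).flip e)
  rw [h]
  exact (u.lTensor L ≪≫ₗ (TensorProduct.assoc R L F N).symm).bijective

lemma lTensor_tensor_exact_of_flat (L : Type*) [AddCommGroup L] [Module R L] [Module.Flat R L]
    {X Y Z : Type*} [AddCommGroup X] [AddCommGroup Y] [AddCommGroup Z] [Module R X] [Module R Y]
    [Module R Z] {a : X →ₗ[R] Y} {b : Y →ₗ[R] Z}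
    (h : Function.Exact (a.lTensor F) (b.lTensor F)) :
    Function.Exact (a.lTensor (L ⊗[R] F)) (b.lTensor (L ⊗[R] F)) := by
  refine (Function.Exact.iff_of_ladder_linearEquiv (e₁ := TensorProduct.assoc R L F X)
    (e₂ := TensorProduct.assoc R L F Y) (e₃ := TensorProduct.assoc R L F Z) ?_ ?_).1
    (Module.Flat.lTensor_exact L h) <;>
  · rw [LinearMap.lTensor_tensor]
    ext
    simp

lemma smul_tensor_quotient_eq_zero (I : Ideal R) {r : R} (hr : r ∈ I) (x : M ⊗[R] (R ⧸ I)) :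
    r • x = 0 := by
  induction x with
  | zero => simp
  | add x y hx hy => rw [smul_add, hx, hy, add_zero]
  | tmul m q =>
    obtain ⟨s, rfl⟩ := Ideal.Quotient.mk_surjective q
    rw [← tmul_smul]
    have : r • Ideal.Quotient.mk I s = 0 := by
      rw [← Ideal.Quotient.mk_eq_mk, ← Submodule.Quotient.mk_smul, Submodule.Quotient.mk_eq_zero]
      exact I.mul_mem_right _ hr
    rw [this, tmul_zero]

lemma smul_ker_eq_zero (I : Ideal R) (g : F ⊗[R] (R ⧸ I) →ₗ[R] M) {r : R} (hr : r ∈ I)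
    (x : g.ker) : r • x = 0 :=
  Subtype.ext (smul_tensor_quotient_eq_zero I hr x.1)

end Unit

section Killed

open TensorProduct

universe v

variable {R : Type v} [CommRing R] (I : Ideal R) {N : Type v} [AddCommGroup N] [Module R N] {e : N}

/-- Every module killed by `I` is a quotient of a base change of `R ⧸ I` along a flat module. -/
lemma exists_flat_tensor_surjective (M : Type v) [AddCommGroup M] [Module R M]
    (hM : ∀ r ∈ I, ∀ m : M, r • m = 0) :
    ∃ (L : Type v) (_ : AddCommGroup L) (_ : Module R L) (_ : Module.Flat R L)
      (g : L ⊗[R] (R ⧸ I) →ₗ[R] M), Function.Surjective g := by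
  classical
  have hM' : Module.IsTorsionBySet R M I := fun m r => hM r r.2 m
  let _ := hM'.module
  have := hM'.isScalarTower (S := R)
  exact ⟨M →₀ R, inferInstance, inferInstance, inferInstance,
    (Finsupp.linearCombination (R ⧸ I) (id : M → M)).restrictScalars R ∘ₗ
      (TensorProduct.finsuppScalarLeft R (R ⧸ I) M).toLinearMap,
    (Finsupp.linearCombination_id_surjective (R ⧸ I) M).comp (LinearEquiv.surjective _)⟩

lemma tmul_bijective_of_smul_eq_zero
    (hI : Function.Bijective fun x : R ⧸ I => x ⊗ₜ[R] e)
    (M : Type v) [AddCommGroup M] [Module R M] (hM : ∀ r ∈ I, ∀ m : M, r • m = 0) :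
    Function.Bijective fun x : M => x ⊗ₜ[R] e := by
  have surj (M : Type v) [AddCommGroup M] [Module R M] (hM : ∀ r ∈ I, ∀ m : M, r • m = 0) :
      Function.Surjective fun x : M => x ⊗ₜ[R] e := by
    obtain ⟨L, _, _, _, g, hg⟩ := exists_flat_tensor_surjective I M hM
    exact tmul_surjective_of_surjective hg (tmul_bijective_of_flat _ hI).2
  obtain ⟨L, _, _, _, g, hg⟩ := exists_flat_tensor_surjective I M hM
  exact ⟨tmul_injective_of_kernel g.exact_subtype_ker_map hg
    (surj g.ker fun _ hr => smul_ker_eq_zero I g hr) (tmul_bijective_of_flat _ hI).1, surj M hM⟩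

lemma rTensor_injective_of_tmul_bijective {K F : Type*} [AddCommGroup K] [AddCommGroup F]
    [Module R K] [Module R F] {f : K →ₗ[R] F} (hf : Function.Injective f)
    (hK : Function.Surjective fun x : K => x ⊗ₜ[R] e)
    (hF : Function.Injective fun x : F => x ⊗ₜ[R] e) : Function.Injective (f.rTensor N) := by
  intro x y hxy
  obtain ⟨x, rfl⟩ := hK x
  obtain ⟨y, rfl⟩ := hK y
  have : f x = f y := hF hxy
  rw [hf this]

variable {C : ℕ → Type v} [∀ i, AddCommGroup (C i)] [∀ i, Module R (C i)]
  [∀ i, Module.Flat R (C i)] {d : ∀ i, C (i + 1) →ₗ[R] C i} {p : C 0 →ₗ[R] N}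

lemma lTensor_exact_of_smul_eq_zero (hd : ∀ i, d i ∘ₗ d (i + 1) = 0)
    (hdp : Function.Exact (d 0) p) (hp : Function.Surjective p)
    (hI : Function.Bijective fun x : R ⧸ I => x ⊗ₜ[R] e)
    (hexact : ∀ i, Function.Exact ((d (i + 1)).lTensor (R ⧸ I)) ((d i).lTensor (R ⧸ I)))
    (M : Type v) [AddCommGroup M] [Module R M] (hM : ∀ r ∈ I, ∀ m : M, r • m = 0) (i : ℕ) :
    Function.Exact ((d (i + 1)).lTensor M) ((d i).lTensor M) := by
  induction i generalizing M with
  | zero =>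
    obtain ⟨L, _, _, _, g, hg⟩ := exists_flat_tensor_surjective I M hM
    have hF := tmul_bijective_of_flat (L) hI
    exact lTensor_exact_of_kernel g.exact_subtype_ker_map hg (hd 0) hdp.linearMap_comp_eq_zero
      (rTensor_injective_of_tmul_bijective g.ker.injective_subtype
        (tmul_bijective_of_smul_eq_zero I hI g.ker fun _ hr => smul_ker_eq_zero I g hr).2 hF.1)
      (lTensor_exact _ hdp hp) (lTensor_tensor_exact_of_flat _ (hexact 0))
  | succ i ih =>
    obtain ⟨L, _, _, _, g, hg⟩ := exists_flat_tensor_surjective I M hM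
    exact lTensor_exact_of_kernel g.exact_subtype_ker_map hg (hd (i + 1)) (hd i)
      (Module.Flat.rTensor_preserves_injective_linearMap _ g.ker.injective_subtype)
      (ih g.ker fun _ hr => smul_ker_eq_zero I g hr) (lTensor_tensor_exact_of_flat _ (hexact (i + 1)))

/-- The local criterion for infinitesimal neighbourhoods, in terms of a flat resolution `C` of `N`:
if `R ⧸ I → (R ⧸ I) ⊗ N` is bijective and `(R ⧸ I) ⊗ C` is acyclic, then the same holds for all
positive powers of `I`. -/
lemma tmul_bijective_and_lTensor_exact_pow (hd : ∀ i, d i ∘ₗ d (i + 1) = 0)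
    (hdp : Function.Exact (d 0) p) (hp : Function.Surjective p)
    (hI : Function.Bijective fun x : R ⧸ I => x ⊗ₜ[R] e)
    (hexact : ∀ i, Function.Exact ((d (i + 1)).lTensor (R ⧸ I)) ((d i).lTensor (R ⧸ I)))
    {n : ℕ} (hn : 1 ≤ n) :
    (Function.Bijective fun x : R ⧸ I ^ n => x ⊗ₜ[R] e) ∧
      ∀ i, Function.Exact ((d (i + 1)).lTensor (R ⧸ I ^ n)) ((d i).lTensor (R ⧸ I ^ n)) := by
  induction n, hn using Nat.le_induction with
  | base => rw [pow_one]; exact ⟨hI, hexact⟩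
  | succ n hn ih =>
    let g : (R ⧸ I ^ (n + 1)) →ₗ[R] R ⧸ I ^ n := Submodule.factor (Ideal.pow_le_pow_right n.le_succ)
    have hg : Function.Surjective g := Submodule.factor_surjective _
    have hfg := g.exact_subtype_ker_map
    have hK : ∀ r ∈ I, ∀ x : g.ker, r • x = 0 := by
      rintro r hr ⟨x, hx⟩
      obtain ⟨s, rfl⟩ := Submodule.Quotient.mk_surjective _ x
      have hs : s ∈ I ^ n := (Submodule.Quotient.mk_eq_zero _).1 hx
      refine Subtype.ext ?_
      change r • Submodule.Quotient.mk s = (0 : R ⧸ I ^ (n + 1))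
      rw [← Submodule.Quotient.mk_smul, Submodule.Quotient.mk_eq_zero, pow_succ', smul_eq_mul]
      exact Ideal.mul_mem_mul hr hs
    have hinj (i : ℕ) : Function.Injective (g.ker.subtype.rTensor (C i)) :=
      Module.Flat.rTensor_preserves_injective_linearMap _ g.ker.injective_subtype
    refine ⟨tmul_bijective_of_extension hfg hg ?_
      (tmul_bijective_of_smul_eq_zero I hI _ hK) ih.1, fun i => ?_⟩
    · exact rTensor_injective_of_lTensor_exact hfg hg (hd 0) hdp hp (hinj 0) (ih.2 0)
    · exact lTensor_exact_of_extension hfg hg (hd i) (hinj i)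
        (lTensor_exact_of_smul_eq_zero I hd hdp hp hI hexact _ hK i) (ih.2 i)

end Killed

open TensorProduct in
lemma quotientMap_bijective_iff_tmul_bijective {A B : Type*} [CommRing A] [CommRing B]
    [Algebra A B] (J : Ideal A) :
    Function.Bijective
      (Ideal.quotientMap (Ideal.map (algebraMap A B) J) (algebraMap A B) Ideal.le_comap_map) ↔
    Function.Bijective fun x : A ⧸ J => x ⊗ₜ[A] (1 : B) := by
  let E := (Algebra.TensorProduct.quotIdealMapEquivTensorQuot B J).toEquiv.trans
    (TensorProduct.comm A B (A ⧸ J)).toEquiv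
  have h : (fun x : A ⧸ J => x ⊗ₜ[A] (1 : B)) = E ∘ Ideal.quotientMap
      (Ideal.map (algebraMap A B) J) (algebraMap A B) Ideal.le_comap_map := by
    funext x
    obtain ⟨a, rfl⟩ := Ideal.Quotient.mk_surjective x
    have h₁ : Algebra.TensorProduct.quotIdealMapEquivTensorQuot B J
        (Ideal.Quotient.mk _ (algebraMap A B a)) = algebraMap A B a ⊗ₜ 1 :=
      Algebra.TensorProduct.quotIdealMapEquivTensorQuot_mk B J _
    have h₂ : Ideal.Quotient.mk J a = a • 1 := by
      rw [Algebra.smul_def, mul_one, Ideal.Quotient.algebraMap_eq]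
    change _ = TensorProduct.comm A B (A ⧸ J) (Algebra.TensorProduct.quotIdealMapEquivTensorQuot B J
      (Ideal.Quotient.mk _ (algebraMap A B a)))
    rw [h₁, TensorProduct.comm_tmul, h₂, smul_tmul, Algebra.algebraMap_eq_smul_one]
  rw [h, E.comp_bijective]

/-- `Tor` in positive degree vanishes iff the tensored projective resolution is exact there. -/
lemma isZero_Tor_succ_iff_lTensor_exact {A : Type u} [CommRing A] {Y : ModuleCat.{u} A}
    (P : ProjectiveResolution Y) (X : ModuleCat.{u} A) (i : ℕ) :
    Limits.IsZero (((Tor (ModuleCat A) (i + 1)).obj X).obj Y) ↔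
      Function.Exact ((P.complex.d (i + 2) (i + 1)).hom.lTensor X)
        ((P.complex.d (i + 1) i).hom.lTensor X) := by
  refine ((P.isoLeftDerivedObj ((MonoidalCategory.tensoringLeft (ModuleCat A)).obj X)
    (i + 1)).isZero_iff).trans ?_
  refine (HomologicalComplex.exactAt_iff_isZero_homology _ _).symm.trans ?_
  rw [HomologicalComplex.exactAt_iff' _ (i + 2) (i + 1) i (by simp) (by simp),
    ShortComplex.ShortExact.moduleCat_exact_iff_function_exact]
  rfl

lemma ProjectiveResolution.flat_X {A : Type u} [CommRing A] {Y : ModuleCat.{u} A}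
    (P : ProjectiveResolution Y) (i : ℕ) : Module.Flat A (P.complex.X i) := by
  have : Projective (ModuleCat.of A (P.complex.X i)) := P.projective i
  have := (IsProjective.iff_projective (P.complex.X i)).2 this
  infer_instance

lemma ProjectiveResolution.exists_augmentation {A : Type u} [CommRing A] {Y : ModuleCat.{u} A}
    (P : ProjectiveResolution Y) :
    ∃ p : P.complex.X 0 →ₗ[A] Y,
      Function.Exact (P.complex.d 1 0).hom p ∧ Function.Surjective p := by
  let s := (HomologicalComplex.singleObjXSelf (ComplexShape.down ℕ) 0 Y).toLinearEquiv
  refine ⟨s.toLinearMap ∘ₗ (P.π.f 0).hom, ?_, ?_⟩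
  · exact ((ShortComplex.ShortExact.moduleCat_exact_iff_function_exact _).1
      P.exact₀).comp_injective _ s.injective (map_zero s)
  · exact s.surjective.comp ((ModuleCat.epi_iff_surjective _).1 inferInstance)

/-- Let `A → A'` be a ring homomorphism and `I ⊆ A` an ideal such that `A/I → A'/IA'` is an
isomorphism and `Tor_i^A(A/I, A') = 0` for all `i > 0`.  Then for every `n ≥ 1`,
`A/I^n → A'/I^n A'` is an isomorphism and `Tor_i^A(A/I^n, A') = 0` for all `i > 0`. -/
theorem stmt3 (A : Type u) [CommRing A] (A' : Type u) [CommRing A'] [Algebra A A']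
    (I : Ideal A)
    (hiso : Function.Bijective
      (Ideal.quotientMap (Ideal.map (algebraMap A A') I) (algebraMap A A') Ideal.le_comap_map))
    (htor : ∀ i : ℕ, 0 < i →
      Limits.IsZero (((Tor (ModuleCat A) i).obj (ModuleCat.of A (A ⧸ I))).obj
        (ModuleCat.of A A'))) :
    ∀ n : ℕ, 1 ≤ n →
      Function.Bijective
        (Ideal.quotientMap (Ideal.map (algebraMap A A') (I ^ n)) (algebraMap A A')
          Ideal.le_comap_map) ∧
      ∀ i : ℕ, 0 < i →
        Limits.IsZero (((Tor (ModuleCat A) i).obj (ModuleCat.of A (A ⧸ I ^ n))).obj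
          (ModuleCat.of A A')) := by
  obtain ⟨P⟩ := HasProjectiveResolution.out (Z := ModuleCat.of A A')
  have flat := ProjectiveResolution.flat_X P
  obtain ⟨p, hdp, hp⟩ := ProjectiveResolution.exists_augmentation P
  have hd (i : ℕ) : (P.complex.d (i + 1) i).hom ∘ₗ (P.complex.d (i + 1 + 1) (i + 1)).hom = 0 := by
    rw [← ModuleCat.hom_comp, P.complex.d_comp_d, ModuleCat.hom_zero]
  have htor' (i : ℕ) := (isZero_Tor_succ_iff_lTensor_exact P _ i).1 (htor (i + 1) i.succ_pos)
  intro n hn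
  obtain ⟨hbij, hexact⟩ := tmul_bijective_and_lTensor_exact_pow (N := A') (e := 1)
    (C := fun i => P.complex.X i) (d := fun i => (P.complex.d (i + 1) i).hom) I hd hdp hp
    ((quotientMap_bijective_iff_tmul_bijective I).1 hiso) htor' hn
  refine ⟨(quotientMap_bijective_iff_tmul_bijective _).2 hbij, fun i hi => ?_⟩
  obtain ⟨i, rfl⟩ := Nat.exists_eq_succ_of_ne_zero hi.ne'
  exact (isZero_Tor_succ_iff_lTensor_exact P _ i).2 (hexact i)
end

section
/- Let A → A' be a ring homomorphism, I an ideal of A, and M an A-module annihilated by I. If A/I → A'/IA' is an isomorphism and Tor_i^A(A/I, A') = 0 for all i > 0, then Tor_i^A(M, A') = 0 for all i > 0 and M → A' ⊗_A M is an isomorphism. -/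
universe u

open CategoryTheory

open scoped TensorProduct

section Splitting

variable {R : Type*} [CommRing R]

/-- If `X → Y → Z` is exact with `Y` projective and `Y → Z` is von Neumann regular with
quasi-inverse `h`, then `id - h ∘ g` factors through `f`. -/
lemma Function.Exact.exists_comp_eq_id_sub {X Y Z : Type*} [AddCommGroup X] [AddCommGroup Y]
    [AddCommGroup Z] [Module R X] [Module R Y] [Module R Z] [Module.Projective R Y]
    {f : X →ₗ[R] Y} {g : Y →ₗ[R] Z} (hfg : Function.Exact f g) {h : Z →ₗ[R] Y}
    (hg : g ∘ₗ h ∘ₗ g = g) : ∃ k : Y →ₗ[R] X, f ∘ₗ k = LinearMap.id - h ∘ₗ g := by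
  obtain ⟨k, hk⟩ := Module.projective_lifting_property f.rangeRestrict
    ((LinearMap.id - h ∘ₗ g).codRestrict (LinearMap.range f) fun y ↦ (hfg _).1 <| by
      have := LinearMap.congr_fun hg y
      simp only [LinearMap.comp_apply] at this
      simp [this]) f.surjective_rangeRestrict
  refine ⟨k, LinearMap.ext fun y ↦ ?_⟩
  exact congrArg Subtype.val (LinearMap.congr_fun hk y)

lemma exists_quasiInverse_of_exact (C : ℕ → Type*) [∀ n, AddCommGroup (C n)]
    [∀ n, Module R (C n)] [∀ n, Module.Projective R (C n)] (d : ∀ n, C (n + 1) →ₗ[R] C n)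
    (hd : ∀ n, Function.Exact (d (n + 1)) (d n))
    (h₀ : ∃ h : C 0 →ₗ[R] C 1, d 0 ∘ₗ h ∘ₗ d 0 = d 0) (n : ℕ) :
    ∃ h : C n →ₗ[R] C (n + 1), d n ∘ₗ h ∘ₗ d n = d n := by
  induction n with
  | zero => exact h₀
  | succ n ih =>
    obtain ⟨h, hh⟩ := ih
    obtain ⟨k, hk⟩ := (hd n).exists_comp_eq_id_sub hh
    refine ⟨k, ?_⟩
    rw [← LinearMap.comp_assoc, hk, LinearMap.sub_comp, LinearMap.comp_assoc,
      (hd n).linearMap_comp_eq_zero]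
    simp

lemma exists_quasiInverse_of_projective_cokernel {X Y Z : Type*} [AddCommGroup X]
    [AddCommGroup Y] [AddCommGroup Z] [Module R X] [Module R Y] [Module R Z]
    [Module.Projective R Y] [Module.Projective R Z] {f : X →ₗ[R] Y} {g : Y →ₗ[R] Z}
    (hfg : Function.Exact f g) (hg : Function.Surjective g) :
    ∃ h : Y →ₗ[R] X, f ∘ₗ h ∘ₗ f = f := by
  obtain ⟨s, hs⟩ := Module.projective_lifting_property g LinearMap.id hg
  obtain ⟨k, hk⟩ := hfg.exists_comp_eq_id_sub (h := s)
    (by rw [← LinearMap.comp_assoc, hs, LinearMap.id_comp])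
  refine ⟨k, ?_⟩
  rw [← LinearMap.comp_assoc, hk, LinearMap.sub_comp, LinearMap.comp_assoc,
    hfg.linearMap_comp_eq_zero]
  simp

lemma Function.Exact.lTensor_of_quasiInverse {X Y Z : Type*} [AddCommGroup X] [AddCommGroup Y]
    [AddCommGroup Z] [Module R X] [Module R Y] [Module R Z] [Module.Projective R Y]
    (M : Type*) [AddCommGroup M] [Module R M]
    {f : X →ₗ[R] Y} {g : Y →ₗ[R] Z} (hfg : Function.Exact f g) {h : Z →ₗ[R] Y}
    (hg : g ∘ₗ h ∘ₗ g = g) : Function.Exact (f.lTensor M) (g.lTensor M) := by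
  obtain ⟨k, hk⟩ := hfg.exists_comp_eq_id_sub hg
  have hk' := congrArg (LinearMap.lTensor M) hk
  rw [LinearMap.lTensor_comp, LinearMap.lTensor_sub, LinearMap.lTensor_id,
    LinearMap.lTensor_comp] at hk'
  intro y
  constructor
  · intro hy
    refine ⟨k.lTensor M y, ?_⟩
    simpa [hy] using LinearMap.congr_fun hk' y
  · rintro ⟨x, rfl⟩
    rw [← LinearMap.comp_apply, ← LinearMap.lTensor_comp, hfg.linearMap_comp_eq_zero]
    simp

end Splitting

section BaseChange

variable {A S M : Type*} [CommRing A] [CommRing S] [Algebra A S] [AddCommGroup M] [Module A M]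
  [Module S M] [IsScalarTower A S M]

lemma exact_lTensor_of_exact_lTensor_baseChange {X Y Z : Type*} [AddCommGroup X]
    [AddCommGroup Y] [AddCommGroup Z] [Module A X] [Module A Y] [Module A Z]
    {f : X →ₗ[A] Y} {g : Y →ₗ[A] Z}
    (hfg : Function.Exact ((f.baseChange S).lTensor M) ((g.baseChange S).lTensor M)) :
    Function.Exact (f.lTensor M) (g.lTensor M) := by
  refine Function.Exact.of_ladder_linearEquiv_of_exact
    (e₁ := TensorProduct.AlgebraTensorModule.cancelBaseChange A S S M X)
    (e₂ := TensorProduct.AlgebraTensorModule.cancelBaseChange A S S M Y)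
    (e₃ := TensorProduct.AlgebraTensorModule.cancelBaseChange A S S M Z)
    (g₁₂ := TensorProduct.AlgebraTensorModule.lTensor S M f)
    (g₂₃ := TensorProduct.AlgebraTensorModule.lTensor S M g) ?_ ?_ hfg
  · ext; simp
  · ext; simp

/-- If `P` is a complex of projective modules over `N` that becomes a resolution of the projective
`S`-module `S ⊗[A] N` after base change to `S`, then tensoring `P` with any `S`-module keeps it
exact in positive degrees. -/
lemma exact_lTensor_of_exact_lTensor (P : ℕ → Type*) [∀ n, AddCommGroup (P n)]
    [∀ n, Module A (P n)] [∀ n, Module.Projective A (P n)] (d : ∀ n, P (n + 1) →ₗ[A] P n)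
    {N : Type*} [AddCommGroup N] [Module A N] [Module.Projective S (S ⊗[A] N)]
    (π : P 0 →ₗ[A] N) (hπ : Function.Exact (d 0) π) (hπ' : Function.Surjective π)
    (hd : ∀ n, Function.Exact ((d (n + 1)).lTensor S) ((d n).lTensor S)) (n : ℕ) :
    Function.Exact ((d (n + 1)).lTensor M) ((d n).lTensor M) := by
  have h₀ : ∃ h : S ⊗[A] P 0 →ₗ[S] S ⊗[A] P 1,
      (d 0).baseChange S ∘ₗ h ∘ₗ (d 0).baseChange S = (d 0).baseChange S :=
    exists_quasiInverse_of_projective_cokernel (g := π.baseChange S)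
      (lTensor_exact S hπ hπ') (LinearMap.lTensor_surjective S hπ')
  obtain ⟨h, hh⟩ := exists_quasiInverse_of_exact (R := S) (fun n ↦ S ⊗[A] P n)
    (fun n ↦ (d n).baseChange S) hd h₀ n
  have hd' : Function.Exact ((d (n + 1)).baseChange S) ((d n).baseChange S) := hd n
  exact exact_lTensor_of_exact_lTensor_baseChange (hd'.lTensor_of_quasiInverse M hh)

end BaseChange

section Tor

lemma isZero_Tor_succ_iff_exact {A : Type u} [CommRing A] (X Y : ModuleCat.{u} A)
    (P : ProjectiveResolution Y) (n : ℕ) :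
    Limits.IsZero (((Tor (ModuleCat A) (n + 1)).obj X).obj Y) ↔
      Function.Exact ((P.complex.d (n + 2) (n + 1)).hom.lTensor X)
        ((P.complex.d (n + 1) n).hom.lTensor X) := by
  rw [Tor_obj, (P.isoLeftDerivedObj _ (n + 1)).isZero_iff]
  erw [← HomologicalComplex.exactAt_iff_isZero_homology]
  rw [HomologicalComplex.exactAt_iff' _ (n + 2) (n + 1) n (by simp) (by simp),
    ShortComplex.ShortExact.moduleCat_exact_iff_function_exact]
  rfl

end Tor

section Quotient

variable {A A' : Type*} [CommRing A] [CommRing A'] [Algebra A A'] {I : Ideal A}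

lemma bijective_toSpanSingleton_quotient_tensor
    (hiso : Function.Bijective
      (Ideal.quotientMap (Ideal.map (algebraMap A A') I) (algebraMap A A') Ideal.le_comap_map)) :
    Function.Bijective
      (LinearMap.toSpanSingleton (A ⧸ I) ((A ⧸ I) ⊗[A] A') (1 ⊗ₜ 1)) := by
  convert (Algebra.TensorProduct.quotIdealMapEquivQuotTensor A' I).bijective.comp hiso using 1
  funext x
  obtain ⟨a, rfl⟩ := Ideal.Quotient.mk_surjective x
  simp only [LinearMap.toSpanSingleton_apply, Function.comp_apply, Ideal.quotientMap_mk,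
    Algebra.TensorProduct.quotIdealMapEquivQuotTensor_mk]
  rw [Algebra.algebraMap_eq_smul_one, TensorProduct.tmul_smul]
  rfl

end Quotient

/-- Let `A → A'` be a ring homomorphism, `I` an ideal of `A`, and `M` an `A`-module
annihilated by `I`.  If `A/I → A'/IA'` is an isomorphism and `Tor_i^A(A/I, A') = 0` for all
`i > 0`, then `Tor_i^A(M, A') = 0` for all `i > 0` and `M → A' ⊗[A] M` is an isomorphism. -/
theorem stmt4 (A : Type u) [CommRing A] (A' : Type u) [CommRing A'] [Algebra A A']
    (I : Ideal A)
    (M : Type u) [AddCommGroup M] [Module A M]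
    (hann : ∀ a ∈ I, ∀ m : M, a • m = 0)
    (hiso : Function.Bijective
      (Ideal.quotientMap (Ideal.map (algebraMap A A') I) (algebraMap A A') Ideal.le_comap_map))
    (htor : ∀ i : ℕ, 0 < i →
      Limits.IsZero (((Tor (ModuleCat A) i).obj (ModuleCat.of A (A ⧸ I))).obj
        (ModuleCat.of A A'))) :
    (∀ i : ℕ, 0 < i →
      Limits.IsZero (((Tor (ModuleCat A) i).obj (ModuleCat.of A M)).obj
        (ModuleCat.of A A'))) ∧
    Function.Bijective (TensorProduct.mk A A' M 1) := by
  have hM : Module.IsTorsionBySet A M I := fun m a ↦ hann a a.2 m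
  let : Module (A ⧸ I) M := hM.module
  have : IsScalarTower A (A ⧸ I) M := hM.isScalarTower
  let e : (A ⧸ I) ≃ₗ[A ⧸ I] (A ⧸ I) ⊗[A] A' :=
    .ofBijective _ (bijective_toSpanSingleton_quotient_tensor hiso)
  have : Module.Projective (A ⧸ I) ((A ⧸ I) ⊗[A] ModuleCat.of A A') := .of_equiv e
  constructor
  · let P : ProjectiveResolution (ModuleCat.of A A') := projectiveResolution _
    intro i hi
    obtain ⟨n, rfl⟩ := Nat.exists_eq_add_of_lt hi
    rw [zero_add, isZero_Tor_succ_iff_exact _ _ P]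
    have (k : ℕ) : Module.Projective A (P.complex.X k) :=
      (IsProjective.iff_projective _).2 (P.projective k)
    let π : P.complex.X 0 ⟶ ModuleCat.of A A' := P.π.f 0
    have hexact : Function.Exact (P.complex.d 1 0).hom π.hom :=
      (ShortComplex.ShortExact.moduleCat_exact_iff_function_exact _).1 P.exact₀
    have hsurj : Function.Surjective π.hom := (ModuleCat.epi_iff_surjective (P.π.f 0)).1 inferInstance
    exact exact_lTensor_of_exact_lTensor (S := A ⧸ I) (fun k ↦ P.complex.X k)
      (fun k ↦ (P.complex.d (k + 1) k).hom) π.hom hexact hsurj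
      (fun k ↦ (isZero_Tor_succ_iff_exact _ _ P k).1 (htor (k + 1) k.succ_pos)) n
  · let E : M ≃ₗ[A] A' ⊗[A] M :=
      ((TensorProduct.rid (A ⧸ I) M).symm ≪≫ₗ e.lTensor M ≪≫ₗ
        TensorProduct.AlgebraTensorModule.cancelBaseChange A (A ⧸ I) (A ⧸ I) M A'
        ).restrictScalars A ≪≫ₗ
        TensorProduct.comm A M A'
    convert E.bijective using 1
    funext m
    simp [E, e]
end

section
/- Let V be a valuation ring, x ∈ V nonzero, and P = {a ∈ V : ν(a) ≥ n·ν(x) for all n}. Then x is a nonzerodivisor on V/P, and consequently Tor_i^V(V/xV, V/P) = 0 for all i > 0. -/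
universe u

open CategoryTheory

open TensorProduct in
/-- In `(R/x) ⊗ M`, the element `1 ⊗ m` vanishes exactly when `m` is divisible by `x`. -/
theorem one_tmul_quotient_span_singleton_eq_zero_iff {R M : Type*} [CommRing R] [AddCommGroup M]
    [Module R M] (x : R) (m : M) :
    (1 : R ⧸ Ideal.span {x}) ⊗ₜ[R] m = 0 ↔ ∃ r : M, m = x • r := by
  rw [← (TensorProduct.quotTensorEquivQuotSMul M (Ideal.span {x})).map_eq_zero_iff,
    ← map_one (Ideal.Quotient.mk (Ideal.span {x})),
    TensorProduct.quotTensorEquivQuotSMul_mk_tmul, one_smul, Submodule.Quotient.mk_eq_zero,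
    Submodule.ideal_span_singleton_smul]
  simp [Submodule.mem_smul_pointwise_iff_exists, eq_comm]

open TensorProduct in
theorem exists_one_tmul_quotient_eq {R M : Type*} [CommRing R] [AddCommGroup M]
    [Module R M] (I : Ideal R) (z : (R ⧸ I) ⊗[R] M) :
    ∃ m : M, z = (1 : R ⧸ I) ⊗ₜ[R] m := by
  induction z with
  | zero => exact ⟨0, by simp⟩
  | add a b ha hb =>
    obtain ⟨m, rfl⟩ := ha
    obtain ⟨n, rfl⟩ := hb
    exact ⟨m + n, (TensorProduct.tmul_add _ _ _).symm⟩
  | tmul a m =>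
    obtain ⟨a, rfl⟩ := Ideal.Quotient.mk_surjective a
    refine ⟨a • m, ?_⟩
    rw [← TensorProduct.smul_tmul, Algebra.smul_def, mul_one, Ideal.Quotient.algebraMap_eq]

open TensorProduct in
/-- If `A → B → C → D` is exact at `B` and `C` and `x` is regular on `D`, then tensoring with
`R/x` preserves exactness at `B`. -/
theorem Function.Exact.lTensor_quotient_span_singleton {R A B C D : Type*} [CommRing R]
    [AddCommGroup A] [Module R A] [AddCommGroup B] [Module R B] [AddCommGroup C] [Module R C]
    [AddCommGroup D] [Module R D] {f : A →ₗ[R] B} {g : B →ₗ[R] C} {h : C →ₗ[R] D}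
    (hfg : Function.Exact f g) (hgh : Function.Exact g h) {x : R} (hx : IsSMulRegular D x) :
    Function.Exact (f.lTensor (R ⧸ Ideal.span {x})) (g.lTensor (R ⧸ Ideal.span {x})) := by
  intro z
  constructor
  · intro hz
    obtain ⟨b, rfl⟩ := exists_one_tmul_quotient_eq _ z
    rw [LinearMap.lTensor_tmul, one_tmul_quotient_span_singleton_eq_zero_iff] at hz
    obtain ⟨c, hc⟩ := hz
    have hhc : h c = 0 := by
      apply hx
      simp only [smul_zero]
      rw [← map_smul, ← hc, hgh.apply_apply_eq_zero]
    obtain ⟨b', rfl⟩ := (hgh c).1 hhc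
    obtain ⟨a, ha⟩ := (hfg (b - x • b')).1 (by rw [map_sub, map_smul, hc, sub_self])
    refine ⟨1 ⊗ₜ a, ?_⟩
    rw [LinearMap.lTensor_tmul, ← sub_eq_zero, ← TensorProduct.tmul_sub,
      one_tmul_quotient_span_singleton_eq_zero_iff]
    exact ⟨-b', by rw [ha, smul_neg]; abel⟩
  · rintro ⟨a, rfl⟩
    rw [← LinearMap.comp_apply, ← LinearMap.lTensor_comp, hfg.linearMap_comp_eq_zero,
      LinearMap.lTensor_zero, LinearMap.zero_apply]

/-- If `x` is regular on both `R` and `M`, then `R/x` and `M` are Tor-independent. -/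
theorem isZero_Tor_quotient_span_singleton {R : Type u} [CommRing R] {x : R} (hx : IsRegular x)
    (M : ModuleCat.{u} R) (hM : IsSMulRegular M x) (n : ℕ) :
    Limits.IsZero (((Tor (ModuleCat R) (n + 1)).obj
      (ModuleCat.of R (R ⧸ Ideal.span {x}))).obj M) := by
  let Q := projectiveResolution M
  refine Limits.IsZero.of_iso ?_ (Q.isoLeftDerivedObj _ (n + 1))
  refine (HomologicalComplex.exactAt_iff_isZero_homology _ _).1 ?_
  rw [HomologicalComplex.exactAt_iff' _ (n + 2) (n + 1) n (by simp) (by simp),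
    ShortComplex.ShortExact.moduleCat_exact_iff_function_exact]
  have hfg := (ShortComplex.ShortExact.moduleCat_exact_iff_function_exact _).1 (Q.exact_succ n)
  cases n with
  | zero =>
    have hgh := (ShortComplex.ShortExact.moduleCat_exact_iff_function_exact _).1 Q.exact₀
    exact Function.Exact.lTensor_quotient_span_singleton (f := (Q.complex.d 2 1).hom)
      (g := (Q.complex.d 1 0).hom) (h := (Q.π.f 0).hom) hfg hgh hM
  | succ k =>
    have hgh := (ShortComplex.ShortExact.moduleCat_exact_iff_function_exact _).1 (Q.exact_succ k)
    have := Q.projective k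
    have : Module.Projective R (Q.complex.X k) := inferInstance
    exact Function.Exact.lTensor_quotient_span_singleton (f := (Q.complex.d (k + 3) (k + 2)).hom)
      (g := (Q.complex.d (k + 2) (k + 1)).hom) (h := (Q.complex.d (k + 1) k).hom) hfg hgh
      (Module.Flat.isSMulRegular_of_isRegular hx)

/-- Let `V` be a valuation ring, `x ∈ V` nonzero, and
`P = {a ∈ V : ν(a) ≥ n·ν(x) for all n}` (equivalently, `x^n ∣ a` for all `n`).  Then `x` is
a nonzerodivisor on `V/P`, and consequently `Tor_i^V(V/xV, V/P) = 0` for all `i > 0`. -/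
theorem stmt11 (V : Type u) [CommRing V] [IsDomain V] [ValuationRing V] (x : V) (hx : x ≠ 0)
    (P : Ideal V) (hP : ∀ a : V, a ∈ P ↔ ∀ n : ℕ, x ^ n ∣ a) :
    (∀ b : V ⧸ P, Ideal.Quotient.mk P x * b = 0 → b = 0) ∧
    ∀ i : ℕ, 0 < i →
      Limits.IsZero (((Tor (ModuleCat V) i).obj (ModuleCat.of V (V ⧸ Ideal.span {x}))).obj
        (ModuleCat.of V (V ⧸ P))) := by
  have hreg : ∀ b : V ⧸ P, Ideal.Quotient.mk P x * b = 0 → b = 0 := by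
    intro b hb
    obtain ⟨b, rfl⟩ := Ideal.Quotient.mk_surjective b
    rw [← map_mul, Ideal.Quotient.eq_zero_iff_mem, hP] at hb
    rw [Ideal.Quotient.eq_zero_iff_mem, hP]
    intro n
    have h := hb (n + 1)
    rwa [pow_succ', mul_dvd_mul_iff_left hx] at h
  refine ⟨hreg, fun i hi => ?_⟩
  obtain ⟨n, rfl⟩ := Nat.exists_eq_succ_of_ne_zero hi.ne'
  refine isZero_Tor_quotient_span_singleton (IsRegular.of_ne_zero hx) _ ?_ n
  exact isSMulRegular_iff_right_eq_zero_of_smul.2 fun b hb => hreg b (by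
    rwa [← Ideal.Quotient.algebraMap_eq, ← Algebra.smul_def])
end

section
/- Let (A, I) be a henselian pair and A → B an integral ring homomorphism. Then (B, IB) is a henselian pair. -/
open Polynomial

universe u

theorem map_le_jacobson_bot_of_isIntegral {A C : Type*} [CommRing A] [CommRing C] [Algebra A C]
    [Algebra.IsIntegral A C] {I : Ideal A} (hI : I ≤ Ideal.jacobson ⊥) :
    I.map (algebraMap A C) ≤ Ideal.jacobson ⊥ := by
  rw [Ideal.jacobson, le_sInf_iff]
  rintro M ⟨-, hM⟩
  rw [Ideal.map_le_iff_le_comap]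
  have := Ideal.isMaximal_comap_of_isIntegral_of_isMaximal (R := A) M
  exact hI.trans (sInf_le ⟨bot_le, this⟩)

theorem isUnit_of_sub_mem_of_le_jacobson_bot {R : Type*} [CommRing R] {I : Ideal R}
    (hI : I ≤ Ideal.jacobson ⊥) {x y : R} (hy : IsUnit y) (h : x - y ∈ I) : IsUnit x := by
  have := isLocalHom_of_le_jacobson_bot I hI
  apply IsUnit.of_map (Ideal.Quotient.mk I)
  rw [Ideal.Quotient.eq.mpr h]
  exact hy.map _

theorem aeval_sub_aeval_mem_map {A U : Type*} [CommRing A] [CommRing U] [Algebra A U]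
    {I : Ideal A} {p q : A[X]}
    (h : p.map (Ideal.Quotient.mk I) = q.map (Ideal.Quotient.mk I)) (x : U) :
    aeval x p - aeval x q ∈ I.map (algebraMap A U) := by
  rw [← map_sub, aeval_eq_sum_range]
  refine Ideal.sum_mem _ fun i _ => ?_
  rw [Algebra.smul_def]
  refine Ideal.mul_mem_right _ _ (Ideal.mem_map_of_mem _ ?_)
  rw [coeff_sub, ← Ideal.Quotient.eq, ← coeff_map, h, coeff_map]

/-- A point `σ : U → R ⧸ I` of a finite `R`-algebra that is cut out modulo `I` by an idempotent
`e` of `U` lifts to a point of `U`, provided that `e` is not killed by any nonzero scalar. -/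
theorem exists_algHom_lift_of_idempotent {R U : Type*} [CommRing R] [CommRing U] [Algebra R U]
    [Module.Finite R U] {I : Ideal R} (hI : I ≤ Ideal.jacobson ⊥) (σ : U →ₐ[R] R ⧸ I) {e : U}
    (he : IsIdempotentElem e) (hσ : σ e = 1)
    (h : ∀ (x : U) (a : R), σ x = Ideal.Quotient.mk I a →
      e * (x - algebraMap R U a) ∈ I.map (algebraMap R U))
    (he_inj : ∀ a : R, a • e = 0 → a = 0) :
    ∃ τ : U →ₐ[R] R, ∀ x, Ideal.Quotient.mk I (τ x) = σ x := by
  let N' : Submodule R U := LinearMap.range (LinearMap.mulLeft R e)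
  have hfg : N'.FG := by
    rw [show N' = Submodule.map (LinearMap.mulLeft R e) ⊤ from LinearMap.range_eq_map _]
    exact Submodule.FG.map _ Module.Finite.fg_top
  have hle : N' ≤ R ∙ e := by
    refine Submodule.le_of_le_smul_of_le_jacobson_bot hfg hI ?_
    rintro _ ⟨x, rfl⟩
    obtain ⟨a, ha⟩ := Ideal.Quotient.mk_surjective (σ x)
    have hx := h x a ha.symm
    have hmem : e * (x - algebraMap R U a) ∈ I • (⊤ : Submodule R U) := by
      rw [Ideal.smul_top_eq_map]; exact hx
    have hmem' := Submodule.mem_map_of_mem (f := LinearMap.mulLeft R e) hmem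
    rw [Submodule.map_smul'', Submodule.map_top] at hmem'
    refine Submodule.mem_sup.mpr ⟨a • e, Submodule.smul_mem _ _
      (Submodule.mem_span_singleton_self e), _, hmem', ?_⟩
    simp only [LinearMap.mulLeft_apply, ← mul_assoc, he.eq, Algebra.smul_def]
    ring
  have hex : ∀ x, ∃ a : R, a • e = e * x := fun x =>
    Submodule.mem_span_singleton.mp (hle ⟨x, rfl⟩)
  choose t ht using hex
  have huniq : ∀ x a, a • e = e * x → t x = a := fun x a hxa => by
    rw [← sub_eq_zero]
    exact he_inj _ (by rw [sub_smul, ht, hxa, sub_self])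
  refine ⟨AlgHom.ofLinearMap ⟨⟨t, fun x y => huniq _ _ ?_⟩, fun a x => huniq _ _ ?_⟩
    (huniq _ _ ?_) fun x y => huniq _ _ ?_, fun x => ?_⟩
  · rw [add_smul, ht, ht, mul_add]
  · simp only [RingHom.id_apply, smul_eq_mul]
    rw [mul_smul, ht, mul_smul_comm]
  · simp
  · calc (t x * t y) • e = (t x * t y) • (e * e) := by rw [he.eq]
      _ = (t x • e) * (t y • e) := by rw [smul_mul_smul_comm]
      _ = (e * e) * (x * y) := by rw [ht, ht]; ring
      _ = e * (x * y) := by rw [he.eq]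
  · have := congrArg σ (ht x)
    rw [map_smul, map_mul, hσ, one_mul, Algebra.smul_def, mul_one] at this
    exact this

/-- If the finite `A`-algebra `U` has, modulo `I`, a direct factor `A ⧸ I` with idempotent `v`,
then `v` satisfies a monic polynomial congruent to `X ^ (n + 1) - X ^ n`. -/
theorem exists_monic_map_eq_and_aeval_eq_zero {A U : Type*} [CommRing A] [CommRing U]
    [Algebra A U] [Module.Finite A U] {I : Ideal A} (σ : U →ₐ[A] A ⧸ I) {v : U} (hσ : σ v = 1)
    (h : ∀ (x : U) (a : A), σ x = Ideal.Quotient.mk I a →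
      v * (x - algebraMap A U a) ∈ I.map (algebraMap A U)) :
    ∃ (n : ℕ) (χ : A[X]), χ.Monic ∧ aeval v χ = 0 ∧
      χ.map (Ideal.Quotient.mk I) = X ^ (n + 1) - X ^ n := by
  classical
  obtain ⟨n, w, hw⟩ := Module.Finite.exists_fin (R := A) (M := U)
  let b : Option (Fin n) → U := fun i => i.elim v w
  have hb : Submodule.span A (Set.range b) = ⊤ := by
    rw [eq_top_iff, ← hw]
    refine Submodule.span_mono ?_
    rintro _ ⟨i, rfl⟩
    exact ⟨some i, rfl⟩
  have hex : ∀ x : U, ∃ a, Ideal.Quotient.mk I a = σ x := fun x => Ideal.Quotient.mk_surjective _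
  choose φ hφ using hex
  have hN : ∀ j, ∃ c : Option (Fin n) → A, (∀ i, c i ∈ I) ∧
      ∑ i, c i • b i = v * (b j - algebraMap A U (φ (b j))) := fun j => by
    have hmem : v * (b j - algebraMap A U (φ (b j))) ∈ I • Submodule.span A (Set.range b) := by
      rw [hb, Ideal.smul_top_eq_map]
      exact h _ _ (hφ _).symm
    obtain ⟨c, hc, hsum⟩ := (Submodule.mem_ideal_smul_span_iff_exists_sum I b _).mp hmem
    exact ⟨c, hc, by rw [← hsum, Finsupp.sum_fintype _ _ (by simp)]⟩
  choose c hcI hc using hN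
  let M : Matrix (Option (Fin n)) (Option (Fin n)) A :=
    Matrix.of fun i j => (if i = none then φ (b j) else 0) + c j i
  have hM : M.Represents b (LinearMap.mulLeft A v) := by
    rw [Matrix.represents_iff']
    intro j
    simp only [M, Matrix.of_apply, add_smul, Finset.sum_add_distrib, hc, ite_smul, zero_smul,
      Finset.sum_ite_eq', Finset.mem_univ, if_true, LinearMap.mulLeft_apply]
    simp only [b, Option.elim, Algebra.smul_def]
    ring
  refine ⟨n, M.charpoly, M.charpoly_monic, ?_, ?_⟩
  · let M' : Matrix.isRepresentation A b := ⟨M, _, hM⟩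
    have h1 : aeval M' M.charpoly = 0 := by
      apply Subtype.ext
      have := Matrix.aeval_self_charpoly M
      rwa [show M = (Matrix.isRepresentation A b).val M' from rfl, aeval_algHom_apply] at this
    have h2 := congrArg (Matrix.isRepresentation.toEnd A b hb) h1
    rw [← aeval_algHom_apply, map_zero,
      Matrix.isRepresentation.eq_toEnd_of_represents A b hb M' hM] at h2
    have h3 := LinearMap.congr_fun h2 1
    rw [show LinearMap.mulLeft A v = Algebra.lmul A U v from rfl, aeval_algHom_apply] at h3
    simpa using h3
  · have hmap : (Ideal.Quotient.mk I).mapMatrix M =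
        Matrix.vecMulVec (Pi.single none 1) (fun j => σ (b j)) := by
      ext i j
      simp only [M, RingHom.mapMatrix_apply, Matrix.map_apply, Matrix.of_apply, map_add,
        Ideal.Quotient.eq_zero_iff_mem.mpr (hcI j i), add_zero, Matrix.vecMulVec_apply,
        Pi.single_apply]
      split_ifs <;> simp [hφ]
    rw [← Matrix.charpoly_map, ← RingHom.mapMatrix_apply, hmap, Matrix.charpoly_vecMulVec]
    simp [b, hσ]

theorem HenselianRing.exists_isIdempotentElem_sub_mem {A U : Type*} [CommRing A] [CommRing U]
    [Algebra A U] [Module.Finite A U] (I : Ideal A) [HenselianRing A I] (σ : U →ₐ[A] A ⧸ I)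
    {v : U} (hσ : σ v = 1)
    (h : ∀ (x : U) (a : A), σ x = Ideal.Quotient.mk I a →
      v * (x - algebraMap A U a) ∈ I.map (algebraMap A U)) :
    ∃ e : U, IsIdempotentElem e ∧ e - v ∈ I.map (algebraMap A U) := by
  obtain ⟨n, χ, hχ, hv, hmap⟩ := exists_monic_map_eq_and_aeval_eq_zero σ hσ h
  have hmap' : (X * χ).map (Ideal.Quotient.mk I) = X ^ (n + 2) - X ^ (n + 1) := by
    rw [Polynomial.map_mul, hmap, map_X]; ring
  obtain ⟨α, hα, hα1⟩ := HenselianRing.is_henselian (I := I) (X * χ) (monic_X.mul hχ) 1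
    (by
      rw [← Ideal.Quotient.eq_zero_iff_mem, ← eval_map_apply, hmap']
      simp)
    (by
      rw [← eval_map_apply, ← derivative_map, hmap']
      simp)
  obtain ⟨q, hq⟩ := dvd_iff_isRoot.mpr hα
  have hα1' : Ideal.Quotient.mk I α = 1 := by
    rw [← map_one (Ideal.Quotient.mk I)]; exact Ideal.Quotient.eq.mpr hα1
  have hqmap : q.map (Ideal.Quotient.mk I) = (X ^ (n + 1) : A[X]).map (Ideal.Quotient.mk I) := by
    refine (monic_X_sub_C (1 : A ⧸ I)).isRegular.left ?_
    have := congrArg (Polynomial.map (Ideal.Quotient.mk I)) hq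
    rw [hmap', Polynomial.map_mul, Polynomial.map_sub, map_X, map_C, hα1'] at this
    simp only [Polynomial.map_pow, map_X]
    rw [← this, C_1]; ring
  have hqα : q.eval α - 1 ∈ I := by
    rw [← Ideal.Quotient.eq, ← eval_map_apply, hqmap, hα1']
    simp
  obtain ⟨w, hw⟩ := isUnit_of_sub_mem_of_le_jacobson_bot
    (HenselianRing.jac (I := I)) isUnit_one hqα
  have hqv : (v - algebraMap A U α) * aeval v q = 0 := by
    have := congrArg (aeval v) hq
    simpa [hv] using this.symm
  have hsq : aeval v q * aeval v q = algebraMap A U (w : A) * aeval v q := by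
    obtain ⟨r, hr⟩ := X_sub_C_dvd_sub_C_eval (a := α) (p := q)
    have := congrArg (aeval v) hr
    simp only [map_sub, map_mul, aeval_X, aeval_C] at this
    rw [hw]
    linear_combination (aeval v q) * this + (aeval v r) * hqv
  have hww : algebraMap A U (↑w⁻¹ : A) * algebraMap A U (w : A) = 1 := by
    rw [← map_mul, Units.inv_mul, map_one]
  refine ⟨algebraMap A U (↑w⁻¹ : A) * aeval v q, ?_, ?_⟩
  · rw [IsIdempotentElem]
    linear_combination (algebraMap A U (↑w⁻¹ : A)) ^ 2 * hsq +
      (algebraMap A U (↑w⁻¹ : A)) * (aeval v q) * hww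
  · have hv2 := h v 1 (by rw [hσ, map_one])
    have hq' := aeval_sub_aeval_mem_map hqmap v
    have hw1 : algebraMap A U (w : A) - 1 ∈ I.map (algebraMap A U) := by
      rw [hw, ← map_one (algebraMap A U), ← map_sub]
      exact Ideal.mem_map_of_mem _ hqα
    simp only [map_pow, aeval_X] at hq'
    rw [← Ideal.Quotient.eq] at hq' hw1 ⊢
    rw [← Ideal.Quotient.eq_zero_iff_mem] at hv2
    have hww' := congrArg (Ideal.Quotient.mk (I.map (algebraMap A U))) hww
    simp only [map_mul, map_pow, map_sub, map_one] at hv2 hq' hw1 hww' ⊢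
    rw [hw1, mul_one] at hww'
    rw [hww', hq', one_mul]
    have hidem : IsIdempotentElem (Ideal.Quotient.mk (I.map (algebraMap A U)) v) := by
      rw [IsIdempotentElem]; linear_combination hv2
    exact hidem.pow_succ_eq n

/-- If the image of `P` in `k` is divisible by `X ^ n`, the factor `X ^ n` lifts to a monic factor
of `P` over a free extension of the base that still maps to `k`. -/
theorem exists_free_monic_factor_map_eq_X_pow {k : Type*} [CommRing k] (n : ℕ) :
    ∀ {R : Type u} [CommRing R] [Algebra R k] {P : R[X]} {H : k[X]}, P.Monic →
      P.map (algebraMap R k) = X ^ n * H →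
      ∃ (S : Type u) (_ : CommRing S) (_ : Algebra R S) (_ : Module.Free R S) (ρ : S →ₐ[R] k)
        (g h : S[X]), g.Monic ∧ h.Monic ∧ P.map (algebraMap R S) = g * h ∧
          g.map (ρ : S →+* k) = X ^ n := by
  induction n with
  | zero =>
    intro R _ _ P H hP _
    exact ⟨R, inferInstance, inferInstance, inferInstance, Algebra.ofId R k, 1, P, monic_one, hP,
      by simp, by simp⟩
  | succ n ih =>
    intro R _ _ P H hP hPH
    have := hP.free_adjoinRoot
    let ρ₁ : AdjoinRoot P →ₐ[R] k := AdjoinRoot.liftAlgHom P (Algebra.ofId R k) 0 (by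
      have : eval 0 (P.map (algebraMap R k)) = 0 := by rw [hPH]; simp
      rw [eval_map] at this
      exact this)
    let : Algebra (AdjoinRoot P) k := ρ₁.toRingHom.toAlgebra
    have : IsScalarTower R (AdjoinRoot P) k := IsScalarTower.of_algebraMap_eq fun x =>
      (ρ₁.commutes x).symm
    have hroot : (P.map (algebraMap R (AdjoinRoot P))).IsRoot (AdjoinRoot.root P) :=
      AdjoinRoot.isRoot_root P
    obtain ⟨Q, hQ⟩ := dvd_iff_isRoot.mpr hroot
    have hQm : Q.Monic := (monic_X_sub_C _).of_mul_monic_left (hQ ▸ hP.map _)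
    have hQH : Q.map (algebraMap (AdjoinRoot P) k) = X ^ n * H := by
      refine monic_X.isRegular.left ?_
      have h0 : algebraMap (AdjoinRoot P) k (AdjoinRoot.root P) = 0 :=
        AdjoinRoot.liftAlgHom_root ..
      have := congrArg (Polynomial.map (algebraMap (AdjoinRoot P) k)) hQ
      rw [Polynomial.map_map, ← IsScalarTower.algebraMap_eq, hPH, Polynomial.map_mul,
        Polynomial.map_sub, map_X, map_C, h0, C_0, sub_zero] at this
      simp only
      rw [← this]; ring
    obtain ⟨S, _, _, _, ρ, g, h, hg, hh, hgh, hgρ⟩ := ih hQm hQH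
    let : Algebra R S := Algebra.compHom S (algebraMap R (AdjoinRoot P))
    have : IsScalarTower R (AdjoinRoot P) S := IsScalarTower.of_algebraMap_eq fun x => rfl
    refine ⟨S, inferInstance, inferInstance, Module.Free.trans (R := R) (S := AdjoinRoot P),
      ρ.restrictScalars R, (X - C (algebraMap _ S (AdjoinRoot.root P))) * g, h,
      (monic_X_sub_C _).mul hg, hh, ?_, ?_⟩
    · rw [IsScalarTower.algebraMap_eq R (AdjoinRoot P) S, ← Polynomial.map_map, hQ,
        Polynomial.map_mul, hgh]
      simp [mul_assoc]
    · have h0 : ρ (algebraMap _ S (AdjoinRoot.root P)) = 0 :=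
        (ρ.commutes _).trans (AdjoinRoot.liftAlgHom_root ..)
      have : ((ρ.restrictScalars R : S →ₐ[R] k) : S →+* k) = (ρ : S →+* k) := rfl
      rw [this, Polynomial.map_mul, hgρ]
      simp [h0, pow_succ']

theorem algHom_quotient_eq_of_sub_mem_map {R U : Type*} [CommRing R] [CommRing U] [Algebra R U]
    {I : Ideal R} (σ : U →ₐ[R] R ⧸ I) {x y : U} (h : x - y ∈ I.map (algebraMap R U)) :
    σ x = σ y := by
  have : I.map (algebraMap R U) ≤ RingHom.ker σ := Ideal.map_le_iff_le_comap.mpr fun a ha =>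
    (σ.commutes a).trans (Ideal.Quotient.eq_zero_iff_mem.mpr ha)
  rw [← sub_eq_zero, ← map_sub]
  exact this h

theorem eq_zero_of_smul_eq_zero_of_isUnit {R U S : Type*} [CommRing R] [CommRing U] [Algebra R U]
    {I : Ideal R} (hI : I ≤ Ideal.jacobson ⊥) [CommRing S] [Algebra R S] [Module.Projective R S]
    (ι : U →ₐ[R] S) (ρ : S →ₐ[R] R ⧸ I) {e : U} (he : ρ (ι e) = 1) {a : R} (ha : a • e = 0) :
    a = 0 := by
  obtain ⟨φ, hφ⟩ := Module.projective_lifting_property (Algebra.linearMap R (R ⧸ I))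
    ρ.toLinearMap Ideal.Quotient.mk_surjective
  have h1 : φ (ι e) - 1 ∈ I := by
    rw [← Ideal.Quotient.eq, map_one, ← he]
    exact LinearMap.congr_fun hφ (ι e)
  have hu := isUnit_of_sub_mem_of_le_jacobson_bot hI isUnit_one h1
  rw [← hu.mul_left_eq_zero, ← smul_eq_mul, ← map_smul, ← map_smul, ha, map_zero, map_zero]

theorem eq_X_pow_and_eq_X_sub_one_pow {L : Type*} [CommRing L] {n : ℕ} (g h : MonicDegreeEq L n)
    (hgh : g.1 * h.1 = X ^ n * (X - 1) ^ n) (h0 : IsUnit (h.1.coeff 0)) :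
    g.1 = X ^ n ∧ h.1 = (X - 1) ^ n := by
  nontriviality L
  have hm : ((X - 1) ^ n : L[X]).Monic := (monic_X_sub_C (1 : L)).pow n
  have hcop : IsCoprime h.1 (X ^ n) := by
    refine IsCoprime.pow_right ?_
    obtain ⟨w, hw⟩ := h0
    refine ⟨C (↑w⁻¹ : L), - C (↑w⁻¹ : L) * h.1.divX, ?_⟩
    have h1 := h.1.divX_mul_X_add
    rw [← hw] at h1
    have h2 : C (↑w⁻¹ : L) * C (w : L) = 1 := by rw [← C_mul, w.inv_mul, C_1]
    linear_combination (-C (↑w⁻¹ : L)) * h1 + h2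
  have hh : h.1 = (X - 1) ^ n := by
    refine (eq_of_monic_of_dvd_of_natDegree_le h.monic hm
      (hcop.dvd_of_dvd_mul_left (hgh ▸ dvd_mul_left _ _)) ?_).symm
    rw [h.natDegree]
    compute_degree
  refine ⟨hm.isRegular.right ?_, hh⟩
  simp only
  rw [← hgh, hh]

open UniversalFactorizationRing in
/-- Over a henselian pair, a factorization `X ^ n * (X - 1) ^ n` modulo `I` lifts. -/
theorem HenselianRing.exists_mul_eq_of_map_eq {A : Type*} [CommRing A] (I : Ideal A)
    [HenselianRing A I] {n : ℕ} {P : A[X]} (hP : P.Monic)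
    (hmap : P.map (Ideal.Quotient.mk I) = X ^ n * (X - 1) ^ n) :
    ∃ g h : A[X], g * h = P ∧ g.map (Ideal.Quotient.mk I) = X ^ n ∧
      h.map (Ideal.Quotient.mk I) = (X - 1) ^ n := by
  have hI : I ≤ Ideal.jacobson ⊥ := HenselianRing.jac
  cases subsingleton_or_nontrivial (A ⧸ I)
  · exact ⟨P, 1, mul_one P, Subsingleton.elim _ _, Subsingleton.elim _ _⟩
  have hm : ((X - 1) ^ n : (A ⧸ I)[X]).Monic := (monic_X_sub_C (1 : A ⧸ I)).pow n
  have hmd : ((X - 1) ^ n : (A ⧸ I)[X]).natDegree = n := by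
    rw [← C_1, (monic_X_sub_C (1 : A ⧸ I)).natDegree_pow, natDegree_X_sub_C, mul_one]
  have hdeg : P.natDegree = n + n := by
    rw [← hP.natDegree_map (Ideal.Quotient.mk I), hmap,
      (monic_X_pow n).natDegree_mul hm, natDegree_X_pow, hmd]
  let p : MonicDegreeEq A (n + n) := MonicDegreeEq.mk P hP hdeg
  obtain ⟨S, _, _, _, ρ, g, h, hg, hh, hgh, hgρ⟩ :=
    exists_free_monic_factor_map_eq_X_pow (k := A ⧸ I) n hP hmap
  have hhρ : h.map (ρ : S →+* A ⧸ I) = (X - 1) ^ n := by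
    refine (monic_X_pow n).isRegular.left ?_
    simp only
    rw [← hgρ, ← Polynomial.map_mul, ← hgh, Polynomial.map_map, hgρ, ← hmap]
    congr 1
    exact ρ.comp_algebraMap
  have hgd : g.natDegree = n := by
    rw [← hg.natDegree_map (ρ : S →+* A ⧸ I), hgρ, natDegree_X_pow]
  have hhd : h.natDegree = n := by
    rw [← hh.natDegree_map (ρ : S →+* A ⧸ I), hhρ, hmd]
  let U := UniversalFactorizationRing n n rfl p
  let ι : U →ₐ[A] S := (homEquiv S n n rfl p).symm
    ⟨(MonicDegreeEq.mk g hg hgd, MonicDegreeEq.mk h hh hhd), hgh.symm⟩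
  have hι := (homEquiv S n n rfl p).apply_symm_apply
    ⟨(MonicDegreeEq.mk g hg hgd, MonicDegreeEq.mk h hh hhd), hgh.symm⟩
  have hι₁ : (factor₁ n n rfl p).1.map (ι : U →+* S) = g := congrArg (fun q => q.1.1.1) hι
  have hι₂ : (factor₂ n n rfl p).1.map (ι : U →+* S) = h := congrArg (fun q => q.1.2.1) hι
  let σ : U →ₐ[A] A ⧸ I := ρ.comp ι
  have hσ₁ : (factor₁ n n rfl p).1.map (σ : U →+* A ⧸ I) = X ^ n := by
    rw [← hgρ, ← hι₁, Polynomial.map_map]; rfl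
  have hσ₂ : (factor₂ n n rfl p).1.map (σ : U →+* A ⧸ I) = (X - 1) ^ n := by
    rw [← hhρ, ← hι₂, Polynomial.map_map]; rfl
  obtain ⟨u, hu⟩ : ∃ u : U, u = (-1) ^ n * (factor₂ n n rfl p).1.coeff 0 := ⟨_, rfl⟩
  have hσu : σ u = 1 := by
    have : σ ((factor₂ n n rfl p).1.coeff 0) = ((X - 1) ^ n : (A ⧸ I)[X]).coeff 0 := by
      rw [← hσ₂, coeff_map]; rfl
    rw [hu, map_mul, map_pow, map_neg, map_one, this, coeff_zero_eq_eval_zero]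
    simp [← mul_pow]
  let L := Localization.Away (Ideal.Quotient.mk (I.map (algebraMap A U)) u)
  let j : U →ₐ[A] L := (IsScalarTower.toAlgHom A (U ⧸ I.map (algebraMap A U)) L).comp
    (Ideal.Quotient.mkₐ A _)
  have hIL : ∀ a ∈ I, algebraMap A L a = 0 := fun a ha => by
    rw [← j.commutes]
    change algebraMap (U ⧸ I.map (algebraMap A U)) L (Ideal.Quotient.mk _ (algebraMap A U a)) = 0
    rw [Ideal.Quotient.eq_zero_iff_mem.mpr (Ideal.mem_map_of_mem _ ha), map_zero]
  let κ : A ⧸ I →ₐ[A] L := Ideal.Quotient.liftₐ I (Algebra.ofId A L) hIL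
  have hju : IsUnit (j u) := 
    IsLocalization.Away.algebraMap_isUnit (Ideal.Quotient.mk (I.map (algebraMap A U)) u)
  have hj : j = κ.comp σ := by
    apply (homEquiv L n n rfl p).injective
    obtain ⟨h₁, h₂⟩ := eq_X_pow_and_eq_X_sub_one_pow ((factor₁ n n rfl p).map (j : U →+* L))
      ((factor₂ n n rfl p).map (j : U →+* L)) (by
        have : (factor₁ n n rfl p).1 * (factor₂ n n rfl p).1 = P.map (algebraMap A U) :=
          factor₁_mul_factor₂ n n rfl p
        change (factor₁ n n rfl p).1.map (j : U →+* L) * (factor₂ n n rfl p).1.map (j : U →+* L) = _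
        rw [← Polynomial.map_mul, this, Polynomial.map_map, j.comp_algebraMap,
          ← κ.comp_algebraMap, ← Polynomial.map_map]
        change (P.map (Ideal.Quotient.mk I)).map _ = _
        rw [hmap]
        simp) (by
        have hju' := (congrArg j hu).trans (map_mul j _ _)
        change IsUnit (((factor₂ n n rfl p).1.map (j : U →+* L)).coeff 0)
        rw [coeff_map]
        exact isUnit_of_mul_isUnit_right (hju' ▸ hju))
    refine Subtype.ext (Prod.ext (Subtype.ext (h₁.trans ?_)) (Subtype.ext (h₂.trans ?_)))
    · change _ = (factor₁ n n rfl p).1.map ((κ : A ⧸ I →+* L).comp (σ : U →+* A ⧸ I))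
      rw [← Polynomial.map_map, hσ₁]
      simp
    · change _ = (factor₂ n n rfl p).1.map ((κ : A ⧸ I →+* L).comp (σ : U →+* A ⧸ I))
      rw [← Polynomial.map_map, hσ₂]
      simp
  have hpow : ∀ (x : U) (a : A), σ x = Ideal.Quotient.mk I a →
      ∃ m, u ^ m * (x - algebraMap A U a) ∈ I.map (algebraMap A U) := fun x a hxa => by
    have hjx : j x = j (algebraMap A U a) := by
      rw [hj]
      change κ (σ x) = κ (σ (algebraMap A U a))
      rw [hxa, σ.commutes]; rfl
    obtain ⟨⟨_, m, rfl⟩, hm⟩ := (IsLocalization.eq_iff_exists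
      (Submonoid.powers (Ideal.Quotient.mk (I.map (algebraMap A U)) u)) L).mp hjx
    refine ⟨m, ?_⟩
    rw [mul_sub, ← Ideal.Quotient.eq, map_mul, map_mul, map_pow]
    exact hm
  obtain ⟨M, hM⟩ := hpow u 1 (by rw [hσu, map_one])
  have hMm : ∀ m, u ^ M * u ^ m - u ^ M ∈ I.map (algebraMap A U) := fun m => by
    rw [← Ideal.Quotient.eq_zero_iff_mem] at hM ⊢
    simp only [map_mul, map_pow, map_sub, map_one] at hM ⊢
    induction m with
    | zero => simp
    | succ m ih =>
      rw [pow_succ]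
      linear_combination (Ideal.Quotient.mk (I.map (algebraMap A U)) u) * ih + hM
  have hσv : σ (u ^ M) = 1 := by rw [map_pow, hσu, one_pow]
  have hv : ∀ (x : U) (a : A), σ x = Ideal.Quotient.mk I a →
      u ^ M * (x - algebraMap A U a) ∈ I.map (algebraMap A U) := fun x a hxa => by
    obtain ⟨m, hm⟩ := hpow x a hxa
    convert Ideal.sub_mem _ (Ideal.mul_mem_left _ (u ^ M) hm)
      (Ideal.mul_mem_left _ (x - algebraMap A U a) (hMm m)) using 1
    ring
  obtain ⟨e, he, hev⟩ := HenselianRing.exists_isIdempotentElem_sub_mem I σ hσv hv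
  have hσe : σ e = 1 := (algHom_quotient_eq_of_sub_mem_map σ hev).trans hσv
  obtain ⟨τ, hτ⟩ := exists_algHom_lift_of_idempotent hI σ he hσe (fun x a hxa => by
      convert Ideal.add_mem _ (Ideal.mul_mem_left _ (x - algebraMap A U a) hev) (hv x a hxa)
        using 1
      ring)
    fun a => eq_zero_of_smul_eq_zero_of_isUnit hI ι ρ hσe
  have hτσ : (Ideal.Quotient.mk I).comp (τ : U →+* A) = σ := RingHom.ext hτ
  refine ⟨(factor₁ n n rfl p).1.map (τ : U →+* A), (factor₂ n n rfl p).1.map (τ : U →+* A),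
    ?_, ?_, ?_⟩
  · have : (factor₁ n n rfl p).1 * (factor₂ n n rfl p).1 = P.map (algebraMap A U) :=
      factor₁_mul_factor₂ n n rfl p
    rw [← Polynomial.map_mul, this, Polynomial.map_map, τ.comp_algebraMap, Algebra.algebraMap_self,
      Polynomial.map_id]
  · rw [Polynomial.map_map, hτσ, hσ₁]
  · rw [Polynomial.map_map, hτσ, hσ₂]

/-- Idempotents modulo `I` of an integral algebra over a henselian pair `(A, I)` lift. -/
theorem HenselianRing.exists_isIdempotentElem_sub_mem_of_isIntegral {A C : Type*} [CommRing A]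
    [CommRing C] [Algebra A C] [Algebra.IsIntegral A C] (I : Ideal A) [HenselianRing A I] {c : C}
    (hc : c ^ 2 - c ∈ I.map (algebraMap A C)) :
    ∃ e : C, IsIdempotentElem e ∧ e - c ∈ I.map (algebraMap A C) := by
  cases subsingleton_or_nontrivial A
  · have := Module.subsingleton A C
    exact ⟨c, Subsingleton.elim _ _, by simp⟩
  obtain ⟨p, hp, hpc, hpI⟩ := exists_monic_aeval_eq_zero_forall_mem_of_mem_map hc
  have hpmap : p.map (Ideal.Quotient.mk I) = X ^ p.natDegree := by
    ext i
    rw [coeff_map, coeff_X_pow]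
    split_ifs with hi
    · rw [hi, hp.coeff_natDegree, map_one]
    · exact Ideal.Quotient.eq_zero_iff_mem.mpr (hpI i hi)
  set n := p.natDegree
  have hqm : (X ^ 2 - X : A[X]).Monic := by monicity!
  have hqd : (X ^ 2 - X : A[X]).natDegree = 2 := by compute_degree!
  have hPm : ((X ^ 2 - X) * p.comp (X ^ 2 - X)).Monic :=
    hqm.mul (hp.comp hqm (by rw [hqd]; norm_num))
  have hPmap : ((X ^ 2 - X) * p.comp (X ^ 2 - X)).map (Ideal.Quotient.mk I) =
      X ^ (n + 1) * (X - 1) ^ (n + 1) := by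
    rw [Polynomial.map_mul, Polynomial.map_comp, hpmap]
    simp only [Polynomial.map_sub, Polynomial.map_pow, map_X, X_pow_comp]
    rw [← pow_succ', ← mul_pow]
    ring
  obtain ⟨g, h, hgh, hg, hh⟩ := HenselianRing.exists_mul_eq_of_map_eq I hPm hPmap
  have hg' : g.map (Ideal.Quotient.mk I) = (X ^ (n + 1) : A[X]).map (Ideal.Quotient.mk I) := by
    simp [hg]
  have hh' : h.map (Ideal.Quotient.mk I) =
      ((X - 1) ^ (n + 1) : A[X]).map (Ideal.Quotient.mk I) := by
    simp [hh]
  have hcop : IsCoprime (X ^ (n + 1) : A[X]) ((X - 1) ^ (n + 1)) :=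
    IsCoprime.pow ⟨1, -1, by ring⟩
  obtain ⟨a, b, hab⟩ := hcop
  have hghc : aeval c g * aeval c h = 0 := by
    rw [← map_mul, hgh, map_mul, aeval_comp]
    simp [hpc]
  have hgc := aeval_sub_aeval_mem_map hg' c
  have hhc := aeval_sub_aeval_mem_map hh' c
  have hw : aeval c a * aeval c g + aeval c b * aeval c h - 1 ∈ I.map (algebraMap A C) := by
    have := Ideal.add_mem _ (Ideal.mul_mem_left _ (aeval c a) hgc)
      (Ideal.mul_mem_left _ (aeval c b) hhc)
    convert this using 1
    have habc := congrArg (aeval c) hab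
    rw [map_add, map_mul, map_mul, map_one] at habc
    linear_combination habc
  obtain ⟨w, hw'⟩ := isUnit_of_sub_mem_of_le_jacobson_bot
    (map_le_jacobson_bot_of_isIntegral (HenselianRing.jac (I := I))) isUnit_one hw
  refine ⟨↑w⁻¹ * (aeval c a * aeval c g), ?_, ?_⟩
  · have hww := w.inv_mul
    rw [IsIdempotentElem]
    linear_combination (- ((w⁻¹ : Cˣ) : C) ^ 2 * aeval c a * aeval c b) * hghc
      + (- ((w⁻¹ : Cˣ) : C) ^ 2 * aeval c a * aeval c g) * hw'
      + (((w⁻¹ : Cˣ) : C) * aeval c a * aeval c g) * hww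
  · rw [← hw'] at hw
    have hww := congrArg (Ideal.Quotient.mk (I.map (algebraMap A C))) w.inv_mul
    rw [← Ideal.Quotient.eq] at hgc hw ⊢
    rw [← Ideal.Quotient.eq_zero_iff_mem] at hc
    have hab' := congrArg (fun f => Ideal.Quotient.mk (I.map (algebraMap A C)) (aeval c f)) hab
    simp only [map_add, map_sub, map_mul, map_pow, map_one, aeval_X] at hab' hc hgc hw hww ⊢
    rw [hw, mul_one] at hww
    have hidem : IsIdempotentElem (Ideal.Quotient.mk (I.map (algebraMap A C)) c) := by
      rw [IsIdempotentElem]; linear_combination hc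
    rw [hidem.pow_succ_eq] at hgc hab'
    have h0 : Ideal.Quotient.mk (I.map (algebraMap A C)) c *
        (Ideal.Quotient.mk (I.map (algebraMap A C)) c - 1) ^ (n + 1) = 0 := by
      rw [pow_succ]; linear_combination (Ideal.Quotient.mk (I.map (algebraMap A C)) c - 1) ^ n * hc
    rw [hww, one_mul, hgc]
    generalize (Ideal.Quotient.mk (I.map (algebraMap A C)) c - 1) ^ (n + 1) = y at *
    linear_combination Ideal.Quotient.mk (I.map (algebraMap A C)) c * hab'
      - Ideal.Quotient.mk (I.map (algebraMap A C)) (aeval c a) * hidem.eq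
      - Ideal.Quotient.mk (I.map (algebraMap A C)) (aeval c b) * h0

/-- Let `(A, I)` be a henselian pair and `A → B` an integral ring homomorphism.  Then
`(B, IB)` is a henselian pair. -/
theorem stmt13 (A : Type*) [CommRing A] (I : Ideal A) [HenselianRing A I]
    (B : Type*) [CommRing B] [Algebra A B] [Algebra.IsIntegral A B] :
    HenselianRing B (I.map (algebraMap A B)) := by
  have hJ : I.map (algebraMap A B) ≤ Ideal.jacobson ⊥ :=
    map_le_jacobson_bot_of_isIntegral HenselianRing.jac
  refine ⟨hJ, fun f hf b₀ hb₀ hb₀' => ?_⟩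
  set J := I.map (algebraMap A B) with hJdef
  have := hf.free_adjoinRoot
  have := hf.finite_adjoinRoot
  have : Algebra.IsIntegral A (AdjoinRoot f) := Algebra.IsIntegral.trans B
  have hmapJ : I.map (algebraMap A (AdjoinRoot f)) = J.map (algebraMap B (AdjoinRoot f)) := by
    rw [hJdef, Ideal.map_map, ← IsScalarTower.algebraMap_eq]
  have := isLocalHom_of_le_jacobson_bot J hJ
  obtain ⟨w, hw⟩ := IsUnit.of_map (Ideal.Quotient.mk J) _ hb₀'
  have hww := w.inv_mul
  obtain ⟨g, hg⟩ := X_sub_C_dvd_sub_C_eval (a := b₀) (p := f)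
  have hgb : g.eval b₀ = w := by
    have := congrArg (fun q => (derivative q).eval b₀) hg
    simpa [hw] using this.symm
  set r := AdjoinRoot.root f
  let σ : AdjoinRoot f →ₐ[B] B ⧸ J := AdjoinRoot.liftAlgHom f (Algebra.ofId B (B ⧸ J))
    (Ideal.Quotient.mk J b₀) (by
      change eval₂ (Ideal.Quotient.mk J) _ f = 0
      rw [eval₂_at_apply]
      exact Ideal.Quotient.eq_zero_iff_mem.mpr hb₀)
  have hσr : σ r = Ideal.Quotient.mk J b₀ := AdjoinRoot.liftAlgHom_root ..
  have hσ : ∀ q : B[X], σ (aeval r q) = Ideal.Quotient.mk J (q.eval b₀) := fun q => by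
    rw [← aeval_algHom_apply, hσr]
    exact aeval_algebraMap_apply_eq_algebraMap_eval b₀ q
  have hfr : aeval r f = 0 := AdjoinRoot.aeval_eq f ▸ AdjoinRoot.mk_self
  have hrg : (r - algebraMap B _ b₀) * aeval r g ∈ J.map (algebraMap B (AdjoinRoot f)) := by
    have := congrArg (aeval r) hg
    simp only [map_sub, map_mul, aeval_X, aeval_C, hfr] at this
    rw [← this, zero_sub, neg_mem_iff]
    exact Ideal.mem_map_of_mem _ hb₀
  have hdiff : ∀ q : B[X], aeval r g * (aeval r q - algebraMap B _ (q.eval b₀)) ∈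
      J.map (algebraMap B (AdjoinRoot f)) := fun q => by
    obtain ⟨s, hs⟩ := X_sub_C_dvd_sub_C_eval (a := b₀) (p := q)
    have := congrArg (aeval r) hs
    simp only [map_sub, map_mul, aeval_X, aeval_C] at this
    rw [this, show ∀ x y z : AdjoinRoot f, x * (y * z) = z * (y * x) by intros; ring]
    exact Ideal.mul_mem_left _ _ hrg
  set v : AdjoinRoot f := algebraMap B _ ↑w⁻¹ * aeval r g with hv
  have hσv : σ v = 1 := by
    rw [hv, map_mul, hσ, hgb, AlgHom.commutes]
    exact (map_mul (Ideal.Quotient.mk J) _ _).symm.trans (by rw [hww, map_one])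
  have hvx : ∀ (x : AdjoinRoot f) (a : B), σ x = Ideal.Quotient.mk J a →
      v * (x - algebraMap B _ a) ∈ J.map (algebraMap B (AdjoinRoot f)) := fun x a hxa => by
    obtain ⟨q, rfl⟩ := AdjoinRoot.mk_surjective x
    rw [← AdjoinRoot.aeval_eq] at hxa ⊢
    rw [hσ, Ideal.Quotient.eq] at hxa
    have h1 := Ideal.mem_map_of_mem (algebraMap B (AdjoinRoot f)) hxa
    convert Ideal.add_mem _ (Ideal.mul_mem_left _ (algebraMap B _ (↑w⁻¹ : B)) (hdiff q))
      (Ideal.mul_mem_left _ v h1) using 1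
    rw [hv, map_sub]; ring
  obtain ⟨e, he, hev⟩ :=
    HenselianRing.exists_isIdempotentElem_sub_mem_of_isIntegral (C := AdjoinRoot f) I (c := v) (by
      rw [hmapJ]
      convert hvx v 1 (by rw [hσv, map_one]) using 1
      rw [map_one]; ring)
  rw [hmapJ] at hev
  have hσe : σ e = 1 := (algHom_quotient_eq_of_sub_mem_map σ hev).trans hσv
  obtain ⟨τ, hτ⟩ := exists_algHom_lift_of_idempotent hJ σ he hσe (fun x a hxa => by
      convert Ideal.add_mem _ (Ideal.mul_mem_left _ (x - algebraMap B _ a) hev) (hvx x a hxa)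
        using 1
      ring)
    fun a => eq_zero_of_smul_eq_zero_of_isUnit hJ (AlgHom.id B _) σ hσe
  refine ⟨τ r, ?_, ?_⟩
  · rw [IsRoot, ← coe_aeval_eq_eval, aeval_algHom_apply, hfr, map_zero]
  · rw [← Ideal.Quotient.eq, hτ, hσr]
end
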